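/- Assume V is finite-dimensional. Let G*: V → V be the linear map determined by g(G*X, Y) = g*(X,Y) for all X,Y (explicitly, G*X = τ(X − ℓ(X)η/L) + ℓ*(X)(η/L + b)), set μ := (L·b² + α)/(L*·τ²), and define H: V → V by H(Y) := τ⁻¹Y + μ·ℓ(Y)·η/L − τ⁻²(ω(Y)·η/L + ℓ(Y)·b). Then G* ∘ H = id_V and H ∘ G* = id_V; in particular g* is nondegenerate with inverse metric g*⁻¹ = τ⁻¹g⁻¹ + μ ℓ♯⊗ℓ♯ − τ⁻²(ℓ♯⊗ω♯ + ω♯⊗ℓ♯). (The inverse metric formula in equation (12) of the paper.) -/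

import Mathlib

open scoped RealInnerProductSpace

noncomputable section

variable {V : Type*} [NormedAddCommGroup V] [InnerProductSpace ℝ V]

/-- `ℓ(X) = g(X,η)/L` with `L = ‖η‖`. -/
def ell (η X : V) : ℝ := ⟪X, η⟫ / ‖η‖

/-- `ω(X) = g(b,X)`. -/
def omega (b X : V) : ℝ := ⟪b, X⟫

/-- `ℓ*(X) = ℓ(X) + ω(X)`. -/
def ellStar (η b X : V) : ℝ := ell η X + omega b X

/-- angular metric `h(X,Y) = g(X,Y) - ℓ(X)ℓ(Y)`. -/
def hAng (η X Y : V) : ℝ := ⟪X, Y⟫ - ell η X * ell η Y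

/-- `τ = L*/L` with `L* = L + α`, `L = ‖η‖`, `α = g(b,η)`. -/
def tau (η b : V) : ℝ := (‖η‖ + ⟪b, η⟫) / ‖η‖

/-- `g*(X,Y) = τ·h(X,Y) + ℓ*(X)ℓ*(Y)`. -/
def gStar (η b X Y : V) : ℝ := tau η b * hAng η X Y + ellStar η b X * ellStar η b Y

/-- The linear map `G*` determined by `g(G*X, Y) = g*(X,Y)`:
`G*X = τ(X - ℓ(X)η/L) + ℓ*(X)(η/L + b)`. -/
def GStar (η b X : V) : V :=
  tau η b • (X - (ell η X / ‖η‖) • η) + ellStar η b X • ((1 / ‖η‖) • η + b)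

/-- `μ = (L·b² + α)/(L*·τ²)`. -/
def mu (η b : V) : ℝ := (‖η‖ * ⟪b, b⟫ + ⟪b, η⟫) / ((‖η‖ + ⟪b, η⟫) * (tau η b) ^ 2)

/-- The candidate inverse `H(Y) = τ⁻¹Y + μ·ℓ(Y)·η/L - τ⁻²(ω(Y)·η/L + ℓ(Y)·b)`,
i.e. the raised-index form of `g*⁻¹ = τ⁻¹g⁻¹ + μ ℓ♯⊗ℓ♯ - τ⁻²(ℓ♯⊗ω♯ + ω♯⊗ℓ♯)`. -/
def Hmap (η b Y : V) : V :=
  (tau η b)⁻¹ • Y + (mu η b * ell η Y / ‖η‖) • η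
    - ((tau η b) ^ 2)⁻¹ • ((omega b Y / ‖η‖) • η + ell η Y • b)

/-- The inverse-metric formula of equation (12): `G*` (the map determined by
`g(G*X,Y) = g*(X,Y)`) is invertible with inverse `H`; in particular `g*` is
nondegenerate with inverse metric
`g*⁻¹ = τ⁻¹g⁻¹ + μ ℓ♯⊗ℓ♯ - τ⁻²(ℓ♯⊗ω♯ + ω♯⊗ℓ♯)`. -/
theorem inverse_metric (η b : V) [FiniteDimensional ℝ V] (hη : η ≠ 0)
    (hLstar : 0 < ‖η‖ + ⟪b, η⟫) :
    (∀ X Y : V, ⟪GStar η b X, Y⟫ = gStar η b X Y) ∧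
      (∀ Y : V, GStar η b (Hmap η b Y) = Y) ∧
      (∀ X : V, Hmap η b (GStar η b X) = X) := by
  have hL : ‖η‖ ≠ 0 := norm_ne_zero_iff.mpr hη
  have hS : ‖η‖ + ⟪b, η⟫ ≠ 0 := hLstar.ne'
  have e1 : ⟪η, η⟫ = ‖η‖ ^ 2 := real_inner_self_eq_norm_sq η
  have e2 : ⟪η, b⟫ = ⟪b, η⟫ := real_inner_comm _ _
  refine ⟨fun X Y => ?_, fun Y => ?_, fun X => ?_⟩
  · have e3 : ⟪η, Y⟫ = ⟪Y, η⟫ := real_inner_comm _ _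
    simp only [GStar, gStar, hAng, ellStar, ell, omega, inner_add_left, inner_sub_left,
      real_inner_smul_left, e3]
    field_simp
  · have e3 : ⟪η, Y⟫ = ⟪Y, η⟫ := real_inner_comm _ _
    simp only [GStar, Hmap, mu, tau, ellStar, ell, omega, inner_add_left, inner_sub_left,
      real_inner_smul_left, inner_add_right, inner_sub_right, real_inner_smul_right, e1, e2, e3]
    generalize ⟪b, b⟫ = B at *
    generalize ⟪Y, η⟫ = y at *
    generalize ⟪b, Y⟫ = w at *
    obtain ⟨a, ha⟩ : ∃ a, a = ‖η‖ + ⟪b, η⟫ := ⟨_, rfl⟩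
    have ha' : ⟪b, η⟫ = a - ‖η‖ := by rw [ha]; ring
    rw [← ha] at hS
    simp only [ha', add_sub_cancel]
    generalize ‖η‖ = L at *
    match_scalars <;> field_simp <;> ring
  · have e3 : ⟪η, X⟫ = ⟪X, η⟫ := real_inner_comm _ _
    simp only [GStar, Hmap, mu, tau, ellStar, ell, omega, inner_add_left, inner_sub_left,
      real_inner_smul_left, inner_add_right, inner_sub_right, real_inner_smul_right, e1, e2, e3]
    generalize ⟪b, b⟫ = B at *
    generalize ⟪X, η⟫ = y at *
    generalize ⟪b, X⟫ = w at *
    obtain ⟨a, ha⟩ : ∃ a, a = ‖η‖ + ⟪b, η⟫ := ⟨_, rfl⟩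
    have ha' : ⟪b, η⟫ = a - ‖η‖ := by rw [ha]; ring
    rw [← ha] at hS
    simp only [ha', add_sub_cancel]
    generalize ‖η‖ = L at *
    match_scalars <;> field_simp <;> ring

end
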